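/- Let ρ be a density matrix on ℂ² ⊗ ℂ² with purity Tr(ρ²) < 1/3. Then every eigenvalue of ρ is at most 1/2, and consequently ρ ∈ 𝔄𝔉₂. In other words, every two-qubit state of purity below 1/3 has absolute fully entangled fraction. -/

import Mathlib

open Matrix Kronecker Complex
open scoped ComplexOrder

/-- The canonical maximally entangled vector `|ψ⁺⟩ = (1/√d) ∑ᵢ |ii⟩` on `ℂ^d ⊗ ℂ^d`. -/
noncomputable def psiPlus (d : ℕ) : (Fin d × Fin d) → ℂ :=
  fun p => if p.1 = p.2 then ((Real.sqrt d)⁻¹ : ℝ) else 0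

/-- The fully entangled fraction: the supremum over `d × d` unitaries `V` of
`⟨ψ⁺| (I ⊗ V)† ρ (I ⊗ V) |ψ⁺⟩`. -/
noncomputable def fef (d : ℕ) (ρ : Matrix (Fin d × Fin d) (Fin d × Fin d) ℂ) : ℝ :=
  ⨆ V : Matrix.unitaryGroup (Fin d) ℂ,
    (star (psiPlus d) ⬝ᵥ
      ((((1 : Matrix (Fin d) (Fin d) ℂ) ⊗ₖ (V : Matrix (Fin d) (Fin d) ℂ))ᴴ * ρ *
        ((1 : Matrix (Fin d) (Fin d) ℂ) ⊗ₖ (V : Matrix (Fin d) (Fin d) ℂ))) *ᵥ psiPlus d)).re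

/-- A density matrix: positive semidefinite with unit trace. -/
def IsDensityMatrix {n : Type*} [Fintype n] (ρ : Matrix n n ℂ) : Prop :=
  ρ.PosSemidef ∧ ρ.trace = 1

/-- `ρ` has absolute fully entangled fraction: `F(UρU†) ≤ 1/d` for every unitary `U`. -/
def AbsFEF (d : ℕ) (ρ : Matrix (Fin d × Fin d) (Fin d × Fin d) ℂ) : Prop :=
  ∀ U ∈ Matrix.unitaryGroup (Fin d × Fin d) ℂ, fef d (U * ρ * Uᴴ) ≤ 1 / d

/-- Basis vector `|ij⟩` of `ℂ^d ⊗ ℂ^d`. -/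
def ket (d : ℕ) (i j : Fin d) : (Fin d × Fin d) → ℂ :=
  fun p => if p = (i, j) then 1 else 0

/-- Rank-one projector `|v⟩⟨v|`. -/
def proj {n : Type*} (v : n → ℂ) : Matrix n n ℂ :=
  Matrix.vecMulVec v (star v)

lemma half_sub_posSemidef {n : Type*} [Fintype n] [DecidableEq n] (ρ : Matrix n n ℂ)
    (h : ρ.IsHermitian) (he : ∀ i, h.eigenvalues i ≤ 1/2) :
    ((1/2 : ℂ) • (1 : Matrix n n ℂ) - ρ).PosSemidef := by
  have hs := h.spectral_theorem
  rw [Unitary.conjStarAlgAut_apply] at hs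
  set W : Matrix n n ℂ := (h.eigenvectorUnitary : Matrix n n ℂ) with hW
  have hWW : W * star W = 1 := Unitary.mul_star_self_of_mem h.eigenvectorUnitary.2
  have key : (1/2 : ℂ) • (1 : Matrix n n ℂ) - ρ
      = W * diagonal (fun i => (1/2 : ℂ) - (h.eigenvalues i : ℂ)) * Wᴴ := by
    rw [← Matrix.diagonal_sub, Matrix.mul_sub, Matrix.sub_mul]
    congr 1
    rw [show (diagonal fun _ : n => (1/2:ℂ)) = (1/2:ℂ) • (1 : Matrix n n ℂ) by
      rw [Matrix.smul_one_eq_diagonal]]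
    rw [Matrix.mul_smul, Matrix.smul_mul, Matrix.mul_one, ← Matrix.star_eq_conjTranspose, hWW]
  rw [key]
  apply Matrix.PosSemidef.mul_mul_conjTranspose_same
  apply Matrix.PosSemidef.diagonal
  intro i
  have := he i
  have h2 : (0:ℝ) ≤ 1/2 - h.eigenvalues i := by linarith
  have h3 : ((0:ℝ):ℂ) ≤ ((1/2 - h.eigenvalues i : ℝ) : ℂ) := Complex.real_le_real.mpr h2
  simpa using h3

lemma trace_sq_eq {n : Type*} [Fintype n] [DecidableEq n] (ρ : Matrix n n ℂ)
    (h : ρ.IsHermitian) : ((ρ * ρ).trace).re = ∑ i, h.eigenvalues i ^ 2 := by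
  have hs := h.spectral_theorem
  rw [Unitary.conjStarAlgAut_apply] at hs
  set W : Matrix n n ℂ := (h.eigenvectorUnitary : Matrix n n ℂ) with hW
  have hWW : star W * W = 1 := Unitary.star_mul_self_of_mem h.eigenvectorUnitary.2
  set D : Matrix n n ℂ := diagonal (RCLike.ofReal ∘ h.eigenvalues) with hD
  have key : ρ * ρ = W * (D * D) * star W := by
    conv_lhs => rw [hs]
    calc W * D * star W * (W * D * star W) = W * D * (star W * W) * D * star W := by
          simp only [Matrix.mul_assoc]
      _ = _ := by rw [hWW]; simp only [Matrix.mul_assoc, Matrix.one_mul]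
  rw [key, Matrix.trace_mul_comm, ← Matrix.mul_assoc, hWW, Matrix.one_mul, hD,
    Matrix.diagonal_mul_diagonal, Matrix.trace_diagonal, Complex.re_sum]
  refine Finset.sum_congr rfl fun i _ => ?_
  simp [pow_two]

lemma psi_norm : star (psiPlus 2) ⬝ᵥ psiPlus 2 = 1 := by
  have : ((√2 : ℝ) : ℂ) * ((√2 : ℝ) : ℂ) = 2 := by
    rw [← Complex.ofReal_mul, Real.mul_self_sqrt (by norm_num)]; norm_num
  simp [psiPlus, dotProduct, Fintype.sum_prod_type, ← mul_inv, this]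

/-- A two-qubit density matrix with purity below `1/3` has all eigenvalues at most `1/2`
and consequently lies in `𝔄𝔉₂`. -/
theorem absFEF_of_purity_lt (ρ : Matrix (Fin 2 × Fin 2) (Fin 2 × Fin 2) ℂ)
    (hρ : IsDensityMatrix ρ) (hpur : ((ρ * ρ).trace).re < 1/3) :
    (∀ i, hρ.1.isHermitian.eigenvalues i ≤ 1/2) ∧ AbsFEF 2 ρ := by
  have hE : ∀ i, hρ.1.isHermitian.eigenvalues i ≤ 1/2 := by
    have h1 := hρ.1.isHermitian.trace_eq_sum_eigenvalues
    replace h1 := hρ.2.symm.trans h1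
    have h1' : ∑ i, hρ.1.isHermitian.eigenvalues i = 1 := by
      have := congrArg Complex.re h1
      simpa using this.symm
    rw [trace_sq_eq ρ hρ.1.isHermitian] at hpur
    generalize hρ.1.isHermitian.eigenvalues = l at *
    simp only [Fintype.sum_prod_type, Fin.sum_univ_two] at h1' hpur
    have aux : ∀ a b c d : ℝ, a + b + c + d = 1 → a^2+b^2+c^2+d^2 < 1/3 → a ≤ 1/2 := by
      intro a b c d hs hq
      by_contra! hc
      have hd : d = 1 - a - b - c := by linarith
      have h3 : (b + c + d)^2 ≤ 3 * (b^2+c^2+d^2) := by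
        nlinarith [sq_nonneg (b-c), sq_nonneg (c-d), sq_nonneg (b-d)]
      rw [show b + c + d = 1 - a by linarith] at h3
      nlinarith
    rintro ⟨i, j⟩
    fin_cases i <;> fin_cases j
    · exact aux _ (l (0,1)) (l (1,0)) (l (1,1)) (by simp; linarith) (by simp; linarith)
    · exact aux _ (l (0,0)) (l (1,0)) (l (1,1)) (by simp; linarith) (by simp; linarith)
    · exact aux _ (l (0,0)) (l (0,1)) (l (1,1)) (by simp; linarith) (by simp; linarith)
    · exact aux _ (l (0,0)) (l (0,1)) (l (1,0)) (by simp; linarith) (by simp; linarith)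
  refine ⟨hE, ?_⟩
  intro U hU
  unfold fef
  refine ciSup_le fun V => ?_
  set A : Matrix (Fin 2 × Fin 2) (Fin 2 × Fin 2) ℂ :=
    (1 : Matrix (Fin 2) (Fin 2) ℂ) ⊗ₖ (V : Matrix (Fin 2) (Fin 2) ℂ) with hA
  have hVV : (V : Matrix (Fin 2) (Fin 2) ℂ)ᴴ * (V : Matrix (Fin 2) (Fin 2) ℂ) = 1 :=
    Unitary.star_mul_self_of_mem V.2
  have hAA : Aᴴ * A = 1 := by
    rw [hA, Matrix.conjTranspose_kronecker, ← Matrix.mul_kronecker_mul, hVV]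
    simp
  have hUU : U * Uᴴ = 1 := Unitary.mul_star_self_of_mem hU
  have hP := half_sub_posSemidef ρ hρ.1.isHermitian hE
  have hP2 := (hP.mul_mul_conjTranspose_same U).conjTranspose_mul_mul_same A
  have hEq : Aᴴ * (U * ((1/2 : ℂ) • 1 - ρ) * Uᴴ) * A = (1/2:ℂ) • 1 - Aᴴ * (U * ρ * Uᴴ) * A := by
    simp only [Matrix.mul_sub, Matrix.sub_mul, Matrix.mul_smul, Matrix.smul_mul, Matrix.mul_one,
      hUU, hAA]
  rw [hEq] at hP2
  have h0 := hP2.dotProduct_mulVec_nonneg (psiPlus 2)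
  rw [Matrix.sub_mulVec, dotProduct_sub, Matrix.smul_mulVec, Matrix.one_mulVec, dotProduct_smul,
    psi_norm] at h0
  have h0' := (Complex.le_def.mp h0).1
  rw [Complex.sub_re] at h0'
  norm_num at h0' ⊢
  linarith
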